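/- For every p > 1, T > 0, and c > 1 there exist constants c₁ > 0 and q ∈ (0,1), depending only on p, T, c, with the following property: if X is a real Banach space having type p with constant at most T, and D is a normalized c-ARS in X, then D is a (c₁, q)-quick representing system in X. -/

import Mathlib

open scoped BigOperators

/-- `X` has (Rademacher) type `p` with constant at most `T`. -/
def HasTypeLe (X : Type*) [NormedAddCommGroup X] [NormedSpace ℝ X] (p T : ℝ) : Prop :=
  ∀ (k : ℕ) (v : Fin k → X),
    (∑ θ : Fin k → Bool, ‖∑ i, (if θ i then (1 : ℝ) else -1) • v i‖ ^ p) / 2 ^ k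
      ≤ T ^ p * ∑ i, ‖v i‖ ^ p

/-- `D` is a `c`-absolutely representing system in `X`. -/
def IsARS {X : Type*} [NormedAddCommGroup X] [NormedSpace ℝ X] (c : ℝ) (D : Set X) : Prop :=
  ∀ x : X, ∃ (a : ℕ → ℝ) (v : ℕ → X), (∀ i, v i ∈ D) ∧
    Summable (fun i => ‖a i • v i‖) ∧
    HasSum (fun i => a i • v i) x ∧
    ∑' i, ‖a i • v i‖ ≤ c * ‖x‖

/-- `D` is a `(c,q)`-quick representing system in `X` (index `i : ℕ` starts at `0`,
so the bound reads `‖aᵢ xᵢ‖ ≤ c q^i`). -/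
def IsQuickRS {X : Type*} [NormedAddCommGroup X] [NormedSpace ℝ X] (c q : ℝ) (D : Set X) :
    Prop :=
  ∀ x : X, ‖x‖ ≤ 1 → ∃ (a : ℕ → ℝ) (v : ℕ → X), (∀ i, v i ∈ D) ∧
    HasSum (fun i => a i • v i) x ∧
    ∀ i, ‖a i • v i‖ ≤ c * q ^ i

open scoped Pointwise Topology
open Filter

/-- The multiples `t • d` of elements `d ∈ D` with `|t| ≤ R`. -/
def boundedMultiples {X : Type*} [NormedAddCommGroup X] [NormedSpace ℝ X] (D : Set X) (R : ℝ) :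
    Set X :=
  {z | ∃ t : ℝ, |t| ≤ R ∧ ∃ d ∈ D, t • d = z}

lemma sum_mem_card_nsmul {ι M : Type*} [AddCommMonoid M] (S : Set M) (A : Finset ι) (v : ι → M)
    (hv : ∀ i ∈ A, v i ∈ S) : ∑ i ∈ A, v i ∈ A.card • S := by
  classical
  induction A using Finset.induction_on with
  | empty => simp
  | insert a A ha ih =>
    rw [Finset.sum_insert ha, Finset.card_insert_of_notMem ha, add_comm (v a), succ_nsmul]
    exact Set.add_mem_add (ih fun i hi => hv i (Finset.mem_insert_of_mem hi))
      (hv a (Finset.mem_insert_self a A))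

section

variable {X : Type*} [NormedAddCommGroup X] [NormedSpace ℝ X]

lemma zero_mem_boundedMultiples {D : Set X} {R : ℝ} (hR : 0 ≤ R) (hD : D.Nonempty) :
    (0 : X) ∈ boundedMultiples D R := by
  obtain ⟨d, hd⟩ := hD
  exact ⟨0, by simpa using hR, d, hd, zero_smul ℝ d⟩

lemma norm_le_of_mem_boundedMultiples {D : Set X} {R : ℝ} (hD : ∀ d ∈ D, ‖d‖ = 1) {z : X}
    (hz : z ∈ boundedMultiples D R) : ‖z‖ ≤ R := by
  obtain ⟨t, ht, d, hd, rfl⟩ := hz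
  rwa [norm_smul, hD d hd, mul_one, Real.norm_eq_abs]

lemma HasTypeLe.exists_signs {p T : ℝ} (hp : 0 < p) (hT : 0 ≤ T) (hX : HasTypeLe X p T)
    {R : ℝ} (hR : 0 ≤ R) {N : ℕ} (v : Fin N → X) (hv : ∀ i, ‖v i‖ ≤ R) :
    ∃ θ : Fin N → Bool,
      ‖∑ i, (if θ i then (1 : ℝ) else -1) • v i‖ ≤ T * R * (N : ℝ) ^ (1 / p) := by
  have hsum : ∑ i, ‖v i‖ ^ p ≤ N * R ^ p := by
    calc ∑ i, ‖v i‖ ^ p ≤ ∑ _i : Fin N, R ^ p :=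
          Finset.sum_le_sum fun i _ => Real.rpow_le_rpow (norm_nonneg _) (hv i) hp.le
      _ = N * R ^ p := by simp
  have hB : T ^ p * (N * R ^ p) = (T * R * (N : ℝ) ^ (1 / p)) ^ p := by
    rw [Real.mul_rpow (by positivity) (by positivity), Real.mul_rpow hT hR,
      ← Real.rpow_mul (by positivity), one_div_mul_cancel hp.ne', Real.rpow_one]
    ring
  have h1 := (hX N v).trans (mul_le_mul_of_nonneg_left hsum (by positivity))
  rw [hB, div_le_iff₀ (by positivity)] at h1
  obtain ⟨θ, -, hθ⟩ := Finset.exists_le_of_sum_le (s := Finset.univ)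
    (f := fun θ : Fin N → Bool => ‖∑ i, (if θ i then (1 : ℝ) else -1) • v i‖ ^ p)
    (g := fun _ => (T * R * (N : ℝ) ^ (1 / p)) ^ p) Finset.univ_nonempty
    (by simpa [mul_comm] using h1)
  exact ⟨θ, (Real.rpow_le_rpow_iff (norm_nonneg _) (by positivity) hp).1 hθ⟩

lemma HasTypeLe.exists_halving {p T : ℝ} (hp : 0 < p) (hT : 0 ≤ T) (hX : HasTypeLe X p T)
    {S : Set X} {R : ℝ} (hR : 0 ≤ R) (hS : ∀ z ∈ S, ‖z‖ ≤ R) (h0 : (0 : X) ∈ S)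
    {n : ℕ} {s : X} (hs : s ∈ (2 * n) • S) :
    ∃ w ∈ n • S, ‖s - (2 : ℝ) • w‖ ≤ T * R * ((2 * n : ℕ) : ℝ) ^ (1 / p) := by
  classical
  obtain ⟨f, rfl⟩ := Set.mem_nsmul.1 hs
  obtain ⟨θ, hθ⟩ := hX.exists_signs hp hT hR (fun i => (f i : X)) fun i => hS _ (f i).2
  have hcard : (Finset.univ.filter fun i => θ i = true).card
      + (Finset.univ.filter fun i => ¬ θ i = true).card = 2 * n := by
    rw [Finset.card_filter_add_card_filter_not]
    simp
  have hfull := Finset.sum_filter_add_sum_filter_not Finset.univ (fun i => θ i = true)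
    (fun i => (f i : X))
  have hsigned : ∑ i, (if θ i then (1 : ℝ) else -1) • (f i : X)
      = ∑ i with θ i = true, (f i : X) - ∑ i with ¬ θ i = true, (f i : X) := by
    rw [← Finset.sum_filter_add_sum_filter_not Finset.univ (fun i => θ i = true),
      sub_eq_add_neg, ← Finset.sum_neg_distrib]
    congr 1 <;> refine Finset.sum_congr rfl fun i hi => ?_
    · simp [(Finset.mem_filter.1 hi).2]
    · simp [(Finset.mem_filter.1 hi).2]
  rw [hsigned] at hθ
  rw [List.sum_ofFn, ← hfull]
  rcases le_total (Finset.univ.filter fun i => θ i = true).card n with h | h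
  · refine ⟨_, Set.nsmul_subset_nsmul_right h0 h
      (sum_mem_card_nsmul S _ (fun i => (f i : X)) fun i _ => (f i).2), ?_⟩
    refine (norm_neg _).symm.trans_le ((congrArg norm ?_).trans_le hθ)
    module
  · refine ⟨_, Set.nsmul_subset_nsmul_right h0 (by omega)
      (sum_mem_card_nsmul S (Finset.univ.filter fun i => ¬ θ i = true)
        (fun i => (f i : X)) fun i _ => (f i).2), ?_⟩
    refine (congrArg norm ?_).trans_le hθ
    module

lemma HasTypeLe.exists_sparse_average {p T : ℝ} (hp : 1 < p) (hT : 0 ≤ T)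
    (hX : HasTypeLe X p T) {S : Set X} {R : ℝ} (hR : 0 ≤ R) (hS : ∀ z ∈ S, ‖z‖ ≤ R)
    (h0 : (0 : X) ∈ S) {r : ℝ} (hr : r = (2 : ℝ) ^ (1 / p - 1)) (hr1 : r < 1) (L k : ℕ)
    {s : X} (hs : s ∈ 2 ^ (L + k) • S) :
    ∃ w ∈ 2 ^ L • S, ‖((2 : ℝ) ^ (L + k))⁻¹ • s - ((2 : ℝ) ^ L)⁻¹ • w‖
      ≤ T * R / (1 - r) * (r ^ L - r ^ (L + k)) := by
  have hr0 : 0 < r := hr ▸ by positivity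
  induction k generalizing s with
  | zero => exact ⟨s, hs, by simp⟩
  | succ k ih =>
    rw [← add_assoc, pow_succ, mul_comm] at hs
    obtain ⟨u, hu, hsu⟩ := hX.exists_halving (by linarith) hT hR hS h0 hs
    obtain ⟨w, hw, huw⟩ := ih hu
    refine ⟨w, hw, ?_⟩
    have hpow : ((2 : ℝ) ^ (L + k + 1))⁻¹ * (((2 * 2 ^ (L + k) : ℕ) : ℝ)) ^ (1 / p)
        = r ^ (L + k + 1) := by
      have hcast : ((2 * 2 ^ (L + k) : ℕ) : ℝ) = 2 ^ (L + k + 1) := by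
        push_cast
        ring
      rw [hcast, hr, ← Real.rpow_pow_comm (by norm_num),
        Real.rpow_sub_one (by norm_num), div_pow]
      exact (div_eq_inv_mul _ _).symm
    have hstep : ‖((2 : ℝ) ^ (L + k + 1))⁻¹ • s - ((2 : ℝ) ^ (L + k))⁻¹ • u‖
        ≤ T * R * r ^ (L + k + 1) := by
      have : ((2 : ℝ) ^ (L + k + 1))⁻¹ • s - ((2 : ℝ) ^ (L + k))⁻¹ • u
          = ((2 : ℝ) ^ (L + k + 1))⁻¹ • (s - (2 : ℝ) • u) := by
        rw [smul_sub, smul_smul, pow_succ]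
        congr 2
        field_simp
      rw [this, norm_smul, Real.norm_of_nonneg (by positivity), ← hpow, mul_left_comm]
      exact mul_le_mul_of_nonneg_left hsu (by positivity)
    have hgeom : T * R * r ^ (L + k + 1)
        ≤ T * R / (1 - r) * (r ^ (L + k) - r ^ (L + k + 1)) := by
      have : T * R / (1 - r) * (r ^ (L + k) - r ^ (L + k + 1)) = T * R * r ^ (L + k) := by
        have : 1 - r ≠ 0 := by linarith
        field_simp
        ring
      rw [this]
      exact mul_le_mul_of_nonneg_left (pow_le_pow_of_le_one hr0.le hr1.le (by omega))
        (by positivity)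
    calc _ ≤ _ := norm_sub_le_norm_sub_add_norm_sub _ (((2 : ℝ) ^ (L + k))⁻¹ • u) _
      _ ≤ _ := add_le_add (hstep.trans hgeom) huw
      _ = _ := by rw [← add_assoc]; ring

lemma eventually_exists_average_near {D : Set X} (hD : ∀ d ∈ D, ‖d‖ = 1) {R : ℝ} (hR : 0 < R)
    {x : X} {a : ℕ → ℝ} {v : ℕ → X} (hv : ∀ i, v i ∈ D)
    (ha : Summable fun i => ‖a i • v i‖) (hx : HasSum (fun i => a i • v i) x)
    (haR : ∑' i, ‖a i • v i‖ ≤ R) {ε : ℝ} (hε : 0 < ε) :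
    ∀ᶠ N : ℕ in atTop, ∃ s ∈ N • boundedMultiples D R, ‖x - (N : ℝ)⁻¹ • s‖ ≤ ε := by
  have hnorm : ∀ i, ‖a i • v i‖ = |a i| := fun i => by
    rw [norm_smul, hD _ (hv i), mul_one, Real.norm_eq_abs]
  simp only [hnorm] at ha haR
  obtain ⟨m, hm⟩ := (Metric.tendsto_atTop.1 hx.tendsto_sum_nat (ε / 2) (by positivity))
  specialize hm m le_rfl
  rw [dist_eq_norm, norm_sub_rev] at hm
  have hlim : Tendsto (fun N : ℕ => m * R / (N : ℝ)) atTop (𝓝 0) :=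
    tendsto_const_div_atTop_nhds_zero_nat _
  filter_upwards [hlim.eventually (gt_mem_nhds (half_pos hε)), eventually_gt_atTop 0]
    with N hN hN0
  have hNpos : (0 : ℝ) < N := by exact_mod_cast hN0
  set k : ℕ → ℕ := fun i => ⌊|a i| * N / R⌋₊ with hk
  set σ : ℕ → ℝ := fun i => (SignType.sign (a i) : ℝ) with hσ
  have hσ1 : ∀ i, |σ i| ≤ 1 := fun i => by
    rcases lt_trichotomy (a i) 0 with h | h | h <;> simp [hσ, h]
  have hkle : ∀ i, (k i : ℝ) ≤ |a i| * N / R := fun i => Nat.floor_le (by positivity)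
  have hksum : ∑ i ∈ Finset.range m, k i ≤ N := by
    have : (∑ i ∈ Finset.range m, (k i : ℝ)) ≤ N := by
      calc ∑ i ∈ Finset.range m, (k i : ℝ) ≤ ∑ i ∈ Finset.range m, |a i| * (N / R) :=
            Finset.sum_le_sum fun i _ => (hkle i).trans_eq (mul_div_assoc _ _ _)
        _ = (∑ i ∈ Finset.range m, |a i|) * (N / R) := by rw [Finset.sum_mul]
        _ ≤ R * (N / R) := by
            gcongr
            exact (ha.sum_le_tsum _ fun i _ => abs_nonneg _).trans haR
        _ = N := by field_simp
    exact_mod_cast this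
  have hmem : ∀ i, (R * σ i) • v i ∈ boundedMultiples D R := fun i =>
    ⟨R * σ i, by
      rw [abs_mul, abs_of_pos hR]
      exact mul_le_of_le_one_right hR.le (hσ1 i), v i, hv i, rfl⟩
  have hpart : ∀ j, ∑ i ∈ Finset.range j, k i • ((R * σ i) • v i)
      ∈ (∑ i ∈ Finset.range j, k i) • boundedMultiples D R := fun j => by
    induction j with
    | zero => simp
    | succ j ih =>
      rw [Finset.sum_range_succ, Finset.sum_range_succ, add_nsmul]
      exact Set.add_mem_add ih (Set.nsmul_mem_nsmul (hmem j))
  refine ⟨_, Set.nsmul_subset_nsmul_right (zero_mem_boundedMultiples hR.le ⟨_, hv 0⟩) hksum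
    (hpart m), ?_⟩
  have hterm : ∀ i, ‖a i • v i - (N : ℝ)⁻¹ • (k i • ((R * σ i) • v i))‖ ≤ R / N := fun i => by
    have h1 : a i • v i - (N : ℝ)⁻¹ • (k i • ((R * σ i) • v i))
        = ((|a i| - k i * R / N) * σ i) • v i := by
      rw [← Nat.cast_smul_eq_nsmul ℝ, smul_smul, smul_smul, ← sub_smul]
      congr 1
      rw [sub_mul, hσ, abs_mul_sign]
      ring
    have h2 : (k i : ℝ) * R / N ≤ |a i| := by
      rw [div_le_iff₀ hNpos, ← le_div_iff₀ hR]
      exact hkle i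
    have h3 : |a i| ≤ k i * R / N + R / N := by
      have := Nat.lt_floor_add_one (|a i| * N / R)
      rw [div_lt_iff₀ hR] at this
      rw [← add_div, le_div_iff₀ hNpos]
      calc |a i| * N ≤ (k i + 1) * R := this.le
        _ = k i * R + R := by ring
    rw [h1, norm_smul, hD _ (hv i), mul_one, Real.norm_eq_abs, abs_mul,
      abs_of_nonneg (sub_nonneg.2 h2)]
    calc _ ≤ (|a i| - k i * R / N) * 1 :=
          mul_le_mul_of_nonneg_left (hσ1 i) (sub_nonneg.2 h2)
      _ ≤ R / N := by linarith
  have hround : ‖∑ i ∈ Finset.range m, a i • v i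
      - (N : ℝ)⁻¹ • ∑ i ∈ Finset.range m, k i • ((R * σ i) • v i)‖ ≤ m * R / N := by
    rw [Finset.smul_sum, ← Finset.sum_sub_distrib]
    refine (norm_sum_le_of_le _ fun i _ => hterm i).trans_eq ?_
    simp [mul_div_assoc]
  have := norm_sub_le_norm_sub_add_norm_sub x (∑ i ∈ Finset.range m, a i • v i)
    ((N : ℝ)⁻¹ • ∑ i ∈ Finset.range m, k i • ((R * σ i) • v i))
  linarith

lemma IsARS.nonempty {D : Set X} {c : ℝ} (h : IsARS c D) : D.Nonempty := by
  obtain ⟨-, v, hv, -⟩ := h 0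
  exact ⟨v 0, hv 0⟩

lemma IsARS.exists_half_approx {p T c : ℝ} (hp : 1 < p) (hT : 0 ≤ T) (hc : 0 < c)
    (hX : HasTypeLe X p T) {D : Set X} (hD : ∀ d ∈ D, ‖d‖ = 1) (hA : IsARS c D)
    {r : ℝ} (hr : r = (2 : ℝ) ^ (1 / p - 1)) (hr1 : r < 1) {L : ℕ}
    (hL : T * c / (1 - r) * r ^ L ≤ 1 / 4) (x : X) :
    ∃ (t : Fin (2 ^ L) → ℝ) (d : Fin (2 ^ L) → X), (∀ i, d i ∈ D) ∧
      (∀ i, |t i| ≤ c * ‖x‖) ∧ ‖x - ∑ i, t i • d i‖ ≤ ‖x‖ / 2 := by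
  obtain ⟨d₀, hd₀⟩ := hA.nonempty
  rcases eq_or_ne x 0 with rfl | hx
  · exact ⟨0, fun _ => d₀, fun _ => hd₀, by simp, by simp⟩
  have hx0 : 0 < ‖x‖ := norm_pos_iff.2 hx
  have hR : 0 < c * ‖x‖ := mul_pos hc hx0
  have hr0 : 0 < r := hr ▸ by positivity
  obtain ⟨a, v, hv, ha, hs, hac⟩ := hA x
  have hev := eventually_exists_average_near hD hR hv ha hs hac (ε := ‖x‖ / 4) (by positivity)
  have hpow : Tendsto (fun k => 2 ^ (L + k)) atTop (atTop : Filter ℕ) :=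
    (tendsto_pow_atTop_atTop_of_one_lt one_lt_two).comp
      (tendsto_add_atTop_nat L |>.congr fun k => add_comm k L)
  obtain ⟨k, s, hsS, hxs⟩ := (hpow.eventually hev).exists
  obtain ⟨w, hw, hsw⟩ := hX.exists_sparse_average hp hT hR.le
    (fun z hz => norm_le_of_mem_boundedMultiples hD hz)
    (zero_mem_boundedMultiples hR.le ⟨d₀, hd₀⟩) hr hr1 L k hsS
  push_cast at hxs
  obtain ⟨f, hf⟩ := Set.mem_nsmul.1 hw
  choose t ht d hd htd using fun i => (f i).2
  refine ⟨fun i => ((2 : ℝ) ^ L)⁻¹ * t i, d, hd, fun i => ?_, ?_⟩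
  · rw [abs_mul, abs_of_nonneg (by positivity)]
    exact (mul_le_of_le_one_left (abs_nonneg _)
      (inv_le_one_of_one_le₀ (one_le_pow₀ one_le_two))).trans (ht i)
  · have hsum : ∑ i, (((2 : ℝ) ^ L)⁻¹ * t i) • d i = ((2 : ℝ) ^ L)⁻¹ • w := by
      rw [← hf, List.sum_ofFn, Finset.smul_sum]
      exact Finset.sum_congr rfl fun i _ => by rw [mul_smul, htd]
    rw [hsum]
    have hbound : T * (c * ‖x‖) / (1 - r) * (r ^ L - r ^ (L + k)) ≤ ‖x‖ / 4 := by
      have h1r : 0 < 1 - r := by linarith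
      calc T * (c * ‖x‖) / (1 - r) * (r ^ L - r ^ (L + k))
          ≤ T * (c * ‖x‖) / (1 - r) * r ^ L :=
            mul_le_mul_of_nonneg_left (by linarith [pow_pos hr0 (L + k)]) (by positivity)
        _ = T * c / (1 - r) * r ^ L * ‖x‖ := by ring
        _ ≤ 1 / 4 * ‖x‖ := mul_le_mul_of_nonneg_right hL hx0.le
        _ = ‖x‖ / 4 := by ring
    have := norm_sub_le_norm_sub_add_norm_sub x (((2 : ℝ) ^ (L + k))⁻¹ • s)
      (((2 : ℝ) ^ L)⁻¹ • w)
    linarith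

lemma half_pow_div_le {n : ℕ} (hn : 0 < n) {q : ℝ} (hq0 : 0 < q) (hq1 : q < 1)
    (hq : q ^ n = 1 / 2) (i : ℕ) : (1 / 2 : ℝ) ^ (i / n) ≤ 2 * q ^ i := by
  have hmod : 1 / 2 ≤ q ^ (i % n) :=
    hq ▸ pow_le_pow_of_le_one hq0.le hq1.le (Nat.mod_lt i hn).le
  have hi : q ^ i = (1 / 2) ^ (i / n) * q ^ (i % n) := by
    rw [← hq, ← pow_mul, ← pow_add, Nat.div_add_mod]
  rw [hi]
  have : (0 : ℝ) < (1 / 2) ^ (i / n) := by positivity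
  nlinarith

lemma isQuickRS_of_half_approx [CompleteSpace X] {D : Set X} {c : ℝ} (hc : 0 < c)
    {n : ℕ} (hn : 0 < n) {q : ℝ} (hq0 : 0 < q) (hq1 : q < 1) (hq : q ^ n = 1 / 2)
    (hD : ∀ d ∈ D, ‖d‖ = 1)
    (H : ∀ x : X, ∃ (t : Fin n → ℝ) (d : Fin n → X), (∀ i, d i ∈ D) ∧
      (∀ i, |t i| ≤ c * ‖x‖) ∧ ‖x - ∑ i, t i • d i‖ ≤ ‖x‖ / 2) :
    IsQuickRS (2 * c) q D := by
  intro x hx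
  choose t d hd ht hrem using H
  set ρ : ℕ → X := fun k => (fun y => y - ∑ i, t y i • d y i)^[k] x with hρ
  have hρ_succ : ∀ k, ρ (k + 1) = ρ k - ∑ i, t (ρ k) i • d (ρ k) i := fun k => by
    simp only [hρ, Function.iterate_succ_apply']
  have hρ_norm : ∀ k, ‖ρ k‖ ≤ (1 / 2) ^ k := fun k => by
    induction k with
    | zero => simpa [hρ] using hx
    | succ k ih =>
      rw [hρ_succ, pow_succ]
      linarith [hrem (ρ k)]
  set a : ℕ → ℝ := fun i => t (ρ (i / n)) ⟨i % n, Nat.mod_lt i hn⟩ with ha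
  set v : ℕ → X := fun i => d (ρ (i / n)) ⟨i % n, Nat.mod_lt i hn⟩ with hv
  have hvD : ∀ i, v i ∈ D := fun i => hd _ _
  have hbound : ∀ i, ‖a i • v i‖ ≤ 2 * c * q ^ i := fun i => by
    rw [norm_smul, hD _ (hvD i), mul_one, Real.norm_eq_abs]
    calc |a i| ≤ c * ‖ρ (i / n)‖ := ht _ _
      _ ≤ c * (2 * q ^ i) := mul_le_mul_of_nonneg_left
          ((hρ_norm _).trans (half_pow_div_le hn hq0 hq1 hq i)) hc.le
      _ = 2 * c * q ^ i := by ring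
  have hsummable : Summable fun i => a i • v i :=
    Summable.of_norm_bounded ((summable_geometric_of_lt_one hq0.le hq1).mul_left _) hbound
  have hpartial : ∀ k, ∑ i ∈ Finset.range (n * k), a i • v i = x - ρ k := fun k => by
    induction k with
    | zero => simp [hρ]
    | succ k ih =>
      have hblock : ∑ j ∈ Finset.range n, a (n * k + j) • v (n * k + j)
          = ∑ i, t (ρ k) i • d (ρ k) i := by
        rw [Finset.sum_range]
        refine Finset.sum_congr rfl fun i _ => ?_
        have h1 : (n * k + i) / n = k := by
          rw [Nat.mul_add_div hn, Nat.div_eq_of_lt i.2, add_zero]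
        have h2 : (n * k + i) % n = i := by
          rw [Nat.mul_add_mod, Nat.mod_eq_of_lt i.2]
        simp only [ha, hv, h1, h2]
      rw [mul_add, mul_one, Finset.sum_range_add, ih, hblock, hρ_succ]
      abel
  have hρ_lim : Tendsto ρ atTop (𝓝 0) :=
    squeeze_zero_norm hρ_norm
      (tendsto_pow_atTop_nhds_zero_of_lt_one (by norm_num) (by norm_num))
  have hlim : Tendsto (fun k => ∑ i ∈ Finset.range (n * k), a i • v i) atTop (𝓝 x) := by
    simpa [hpartial] using tendsto_const_nhds.sub hρ_lim
  have hlim' := hsummable.hasSum.tendsto_sum_nat.comp (tendsto_id.const_mul_atTop' hn)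
  have hx_eq := tendsto_nhds_unique hlim' hlim
  exact ⟨a, v, hvD, hx_eq ▸ hsummable.hasSum, hbound⟩

end

/-- For every `p > 1`, `T > 0` and `c > 1` there are `c₁ > 0` and `q ∈ (0,1)` such that
every normalized `c`-ARS in a Banach space of type `p` with constant at most `T` is a
`(c₁,q)`-quick representing system. -/
theorem stmt18 (p T c : ℝ) (hp : 1 < p) (hT : 0 < T) (hc : 1 < c) :
    ∃ c₁ > (0 : ℝ), ∃ q ∈ Set.Ioo (0 : ℝ) 1,
      ∀ (X : Type*) [NormedAddCommGroup X] [NormedSpace ℝ X] [CompleteSpace X]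
        (D : Set X), HasTypeLe X p T → (∀ d ∈ D, ‖d‖ = 1) → IsARS c D →
          IsQuickRS c₁ q D := by
  set r : ℝ := (2 : ℝ) ^ (1 / p - 1) with hr
  have hr0 : 0 < r := by positivity
  have hr1 : r < 1 := Real.rpow_lt_one_of_one_lt_of_neg one_lt_two
    (sub_neg.2 ((div_lt_one (by linarith)).2 hp))
  have hlim : Tendsto (fun L : ℕ => T * c / (1 - r) * r ^ L) atTop (𝓝 0) := by
    simpa using (tendsto_pow_atTop_nhds_zero_of_lt_one hr0.le hr1).const_mul (T * c / (1 - r))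
  obtain ⟨L, hL⟩ := (hlim.eventually (gt_mem_nhds (by norm_num : (0 : ℝ) < 1 / 4))).exists
  have hn : 0 < 2 ^ L := by positivity
  have hq : ((1 / 2 : ℝ) ^ (((2 ^ L : ℕ) : ℝ)⁻¹)) ^ (2 ^ L) = 1 / 2 :=
    Real.rpow_inv_natCast_pow (by norm_num) hn.ne'
  have hq0 : 0 < (1 / 2 : ℝ) ^ (((2 ^ L : ℕ) : ℝ)⁻¹) := by positivity
  have hq1 : (1 / 2 : ℝ) ^ (((2 ^ L : ℕ) : ℝ)⁻¹) < 1 :=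
    Real.rpow_lt_one (by norm_num) (by norm_num) (by positivity)
  refine ⟨2 * c, by linarith, _, ⟨hq0, hq1⟩, ?_⟩
  intro X _ _ _ D hX hD hA
  have hc0 : 0 < c := by linarith
  exact isQuickRS_of_half_approx hc0 hn hq0 hq1 hq hD
    (hA.exists_half_approx hp hT.le hc0 hX hD hr hr1 hL.le)
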